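/- arXiv:1003.5280 — 2 statements merged into one kernel-verified Lean document; each statement's English description precedes it below -/
import Mathlib

section
/- Let G ⊆ GL(V) be a finite pseudo reflection group and let s₁, s₂ ∈ R be pseudo reflections with reflection hyperplanes H_{i₁}, H_{i₂} that do not commute: s₁s₂ ≠ s₂s₁. Then {i₁, i₂} is a proper subset of {k ∈ P : H_k ⊇ H_{i₁} ∩ H_{i₂}}; that is, there exists a pseudo reflection s ∈ R whose reflection hyperplane H_s contains H_{i₁} ∩ H_{i₂} and is different from both H_{i₁} and H_{i₂}. -/
noncomputable section

open scoped Classical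

namespace PRG

variable {V : Type*} [AddCommGroup V] [Module ℂ V]

/-- `s` is a pseudo reflection: an invertible endomorphism of finite order whose fixed
subspace is a hyperplane (a codimension one subspace). -/
def IsPRefl (s : (Module.End ℂ V)ˣ) : Prop :=
  IsOfFinOrder s ∧
    Module.finrank ℂ (LinearMap.ker ((s : Module.End ℂ V) - 1)) + 1 = Module.finrank ℂ V

/-- The reflection hyperplane of a pseudo reflection: its fixed subspace. -/
def hypOf (s : (Module.End ℂ V)ˣ) : Submodule ℂ V :=
  LinearMap.ker ((s : Module.End ℂ V) - 1)

variable (G : Subgroup (Module.End ℂ V)ˣ)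

/-- The set `R` of pseudo reflections contained in `G`. -/
def Rset : Set ↥G := {s | IsPRefl (s : (Module.End ℂ V)ˣ)}

/-- `G` is a pseudo reflection group: it is generated by the pseudo reflections it contains. -/
def IsPseudoReflectionGroup : Prop :=
  Subgroup.closure {s : (Module.End ℂ V)ˣ | ∃ h : s ∈ G, (⟨s, h⟩ : ↥G) ∈ Rset G} = G

/-- The set `P` of reflection hyperplanes of `G`. -/
def Pset : Set (Submodule ℂ V) := (fun s : ↥G => hypOf (s : (Module.End ℂ V)ˣ)) '' Rset G

/-- The set `R(i,j)` of pseudo reflections of `G` mapping the hyperplane `j` to the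
hyperplane `i`. -/
def Rij (i j : Submodule ℂ V) : Set ↥G :=
  {s | s ∈ Rset G ∧ Submodule.map ((s : (Module.End ℂ V)ˣ) : Module.End ℂ V) j = i}

/-- Conjugacy-class invariance of the parameters `μ`. -/
def MuAdmissible (μ : ↥G → ℂ) : Prop :=
  ∀ s t : ↥G, s ∈ Rset G → t ∈ Rset G → (∃ w : ↥G, w * s * w⁻¹ = t) → μ s = μ t

/-- Orbit invariance of the parameters `m`. -/
def MAdmissible (mc : Submodule ℂ V → ℂ) : Prop :=
  ∀ i j, i ∈ Pset G → j ∈ Pset G →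
    (∃ w : ↥G, Submodule.map ((w : (Module.End ℂ V)ˣ) : Module.End ℂ V) i = j) → mc i = mc j

/-- The generator `w̄` of the free algebra, for `w ∈ G`. -/
def gg (w : ↥G) : FreeAlgebra ℂ (↥G ⊕ ↥(Pset G)) := FreeAlgebra.ι ℂ (Sum.inl w)

/-- The generator `e_i` of the free algebra, for `i ∈ P`. -/
def ee (i : ↥(Pset G)) : FreeAlgebra ℂ (↥G ⊕ ↥(Pset G)) := FreeAlgebra.ι ℂ (Sum.inr i)

/-- The defining relations of the algebra `B_G(Υ)` (Definition 5.1). -/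
inductive BRel (μ : ↥G → ℂ) (mc : Submodule ℂ V → ℂ) :
    FreeAlgebra ℂ (↥G ⊕ ↥(Pset G)) → FreeAlgebra ℂ (↥G ⊕ ↥(Pset G)) → Prop
  | grp_one : BRel μ mc (gg G 1) 1
  | grp_mul (w₁ w₂ : ↥G) : BRel μ mc (gg G w₁ * gg G w₂) (gg G (w₁ * w₂))
  | refl_e (s : ↥G) (i : ↥(Pset G)) (hs : s ∈ Rset G)
      (hhyp : hypOf (s : (Module.End ℂ V)ˣ) = (i : Submodule ℂ V)) :
      BRel μ mc (gg G s * ee G i) (ee G i)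
  | e_refl (s : ↥G) (i : ↥(Pset G)) (hs : s ∈ Rset G)
      (hhyp : hypOf (s : (Module.End ℂ V)ˣ) = (i : Submodule ℂ V)) :
      BRel μ mc (ee G i * gg G s) (ee G i)
  | e_sq (i : ↥(Pset G)) : BRel μ mc (ee G i * ee G i) (mc (i : Submodule ℂ V) • ee G i)
  | move (w : ↥G) (i j : ↥(Pset G))
      (h : Submodule.map ((w : (Module.End ℂ V)ˣ) : Module.End ℂ V) (j : Submodule ℂ V)
        = (i : Submodule ℂ V)) :
      BRel μ mc (gg G w * ee G j) (ee G i * gg G w)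
  | e_comm (i j : ↥(Pset G))
      (h : {k : ↥(Pset G) | (i : Submodule ℂ V) ⊓ (j : Submodule ℂ V) ≤ (k : Submodule ℂ V)}
        = {i, j}) :
      BRel μ mc (ee G i * ee G j) (ee G j * ee G i)
  | e_sum (i j : ↥(Pset G))
      (h : {k : ↥(Pset G) | (i : Submodule ℂ V) ⊓ (j : Submodule ℂ V) ≤ (k : Submodule ℂ V)}
        ≠ {i, j})
      (h2 : (Rij G (i : Submodule ℂ V) (j : Submodule ℂ V)).Nonempty) :
      BRel μ mc (ee G i * ee G j)
        ((∑ᶠ s ∈ Rij G (i : Submodule ℂ V) (j : Submodule ℂ V), μ s • gg G s) * ee G j)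
  | e_zero (i j : ↥(Pset G))
      (h : {k : ↥(Pset G) | (i : Submodule ℂ V) ⊓ (j : Submodule ℂ V) ≤ (k : Submodule ℂ V)}
        ≠ {i, j})
      (h2 : Rij G (i : Submodule ℂ V) (j : Submodule ℂ V) = ∅) :
      BRel μ mc (ee G i * ee G j) 0

/-- The algebra `B_G(Υ)` associated with the pseudo reflection group `G` and the
parameters `Υ = (μ, m)` (Definition 5.1). -/
def BAlg (μ : ↥G → ℂ) (mc : Submodule ℂ V → ℂ) : Type _ := RingQuot (BRel G μ mc)

instance (μ : ↥G → ℂ) (mc : Submodule ℂ V → ℂ) : Ring (BAlg G μ mc) :=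
  inferInstanceAs (Ring (RingQuot (BRel G μ mc)))

instance (μ : ↥G → ℂ) (mc : Submodule ℂ V → ℂ) : Algebra ℂ (BAlg G μ mc) :=
  inferInstanceAs (Algebra ℂ (RingQuot (BRel G μ mc)))

variable (μ : ↥G → ℂ) (mc : Submodule ℂ V → ℂ)

/-- The image `w̄ ∈ B_G(Υ)` of a group element `w ∈ G`. -/
def wbar (w : ↥G) : BAlg G μ mc := RingQuot.mkAlgHom ℂ (BRel G μ mc) (gg G w)

/-- The generator `e_i ∈ B_G(Υ)` for a reflection hyperplane `i ∈ P`. -/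
def ebar (i : ↥(Pset G)) : BAlg G μ mc := RingQuot.mkAlgHom ℂ (BRel G μ mc) (ee G i)

/-- `w ↦ w̄` as a monoid homomorphism `G →* B_G(Υ)`. -/
def wbarMonoidHom : ↥G →* BAlg G μ mc where
  toFun := wbar G μ mc
  map_one' := by
    have h := RingQuot.mkAlgHom_rel ℂ (BRel.grp_one (G := G) (μ := μ) (mc := mc))
    rw [map_one] at h
    exact h
  map_mul' w₁ w₂ := by
    have h := RingQuot.mkAlgHom_rel ℂ (BRel.grp_mul (μ := μ) (mc := mc) w₁ w₂)
    rw [map_mul] at h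
    exact h.symm

/-- The natural algebra homomorphism `ℂG → B_G(Υ)` induced by `w ↦ w̄`. -/
def groupAlgebraMap : MonoidAlgebra ℂ ↥G →ₐ[ℂ] BAlg G μ mc :=
  MonoidAlgebra.lift ℂ (BAlg G μ mc) ↥G (wbarMonoidHom G μ mc)

end PRG

open PRG in
theorem aux_form {V : Type*} [AddCommGroup V] [Module ℂ V] [FiniteDimensional ℂ V]
    (s : (Module.End ℂ V)ˣ) (hs : IsPRefl s) :
    ∃ (f : V →ₗ[ℂ] ℂ) (a : V), a ≠ 0 ∧ ∀ v, (s : Module.End ℂ V) v = v + f v • a := by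
  have h1 := LinearMap.finrank_range_add_finrank_ker ((s : Module.End ℂ V) - 1)
  have h2 : Module.finrank ℂ (LinearMap.range ((s : Module.End ℂ V) - 1)) = 1 := by
    have := hs.2
    omega
  let e := (LinearEquiv.ofFinrankEq (LinearMap.range ((s : Module.End ℂ V) - 1)) ℂ
    (by rw [h2, Module.finrank_self]))
  refine ⟨e.toLinearMap ∘ₗ ((s : Module.End ℂ V) - 1).rangeRestrict, (e.symm 1 : _), ?_, ?_⟩
  · intro h
    have h3 : e.symm 1 = 0 := Subtype.ext h
    simp at h3
  · intro v
    have h3 : ∀ x, e x • e.symm 1 = x := by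
      intro x
      rw [← map_smul]
      simp
    have h4 := congrArg Subtype.val (h3 (((s : Module.End ℂ V) - 1).rangeRestrict v))
    have h5 : (((s : Module.End ℂ V) - 1).rangeRestrict v : V) = (s : Module.End ℂ V) v - v := rfl
    rw [h5] at h4
    have h6 : (s : Module.End ℂ V) v = v + ((s : Module.End ℂ V) v - v) := by abel
    rw [h6, ← h4]
    rfl

open PRG in
theorem aux_mem {V : Type*} [AddCommGroup V] [Module ℂ V]
    (s : (Module.End ℂ V)ˣ) (v : V) : v ∈ hypOf s ↔ (s : Module.End ℂ V) v = v := by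
  simp [hypOf, sub_eq_zero]

open PRG in
theorem aux_mem' {V : Type*} [AddCommGroup V] [Module ℂ V]
    (s : (Module.End ℂ V)ˣ) (f : V →ₗ[ℂ] ℂ) (a : V) (ha : a ≠ 0)
    (h : ∀ v, (s : Module.End ℂ V) v = v + f v • a) (v : V) : v ∈ hypOf s ↔ f v = 0 := by
  rw [aux_mem, h]
  simp [ha]

theorem aux_inv {V : Type*} [AddCommGroup V] [Module ℂ V]
    (s : (Module.End ℂ V)ˣ) (v : V) :
    ((s⁻¹ : (Module.End ℂ V)ˣ) : Module.End ℂ V) ((s : Module.End ℂ V) v) = v := by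
  rw [← Module.End.mul_apply, Units.inv_mul, Module.End.one_apply]

theorem aux_inv' {V : Type*} [AddCommGroup V] [Module ℂ V]
    (s : (Module.End ℂ V)ˣ) (v : V) :
    (s : Module.End ℂ V) (((s⁻¹ : (Module.End ℂ V)ˣ) : Module.End ℂ V) v) = v := by
  rw [← Module.End.mul_apply, Units.mul_inv, Module.End.one_apply]

open PRG in
theorem aux_conj {V : Type*} [AddCommGroup V] [Module ℂ V]
    (s t : (Module.End ℂ V)ˣ) (v : V) :
    (s : Module.End ℂ V) v ∈ hypOf (s * t * s⁻¹) ↔ v ∈ hypOf t := by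
  rw [aux_mem, aux_mem]
  simp only [Units.val_mul, Module.End.mul_apply, aux_inv]
  constructor
  · intro h
    have := congrArg ((s⁻¹ : (Module.End ℂ V)ˣ) : Module.End ℂ V) h
    simpa only [aux_inv] using this
  · intro h
    rw [h]

open PRG in
theorem aux_conj_refl {V : Type*} [AddCommGroup V] [Module ℂ V] [FiniteDimensional ℂ V]
    (G : Subgroup (Module.End ℂ V)ˣ) [Finite ↥G] (s t : ↥G) (ht : t ∈ Rset G) :
    s * t * s⁻¹ ∈ Rset G := by
  refine ⟨?_, ?_⟩
  · exact G.subtype.isOfFinOrder (isOfFinOrder_of_finite (s * t * s⁻¹))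
  · rw [← ht.2]
    congr 1
    have hm : hypOf ((s * t * s⁻¹ : ↥G) : (Module.End ℂ V)ˣ)
        = Submodule.map (((s : (Module.End ℂ V)ˣ) : Module.End ℂ V))
          (hypOf (t : (Module.End ℂ V)ˣ)) := by
      ext v
      rw [Submodule.mem_map]
      constructor
      · intro hv
        refine ⟨(((s : (Module.End ℂ V)ˣ)⁻¹ : (Module.End ℂ V)ˣ) : Module.End ℂ V) v, ?_,
          aux_inv' _ _⟩
        rw [← aux_conj (s : (Module.End ℂ V)ˣ), aux_inv']
        exact hv
      · rintro ⟨w, hw, rfl⟩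
        exact (aux_conj _ _ _).2 hw
    change Module.finrank ℂ (hypOf _) = Module.finrank ℂ (hypOf _)
    rw [hm]
    refine (LinearEquiv.finrank_eq (Submodule.equivMapOfInjective _ ?_ _)).symm
    intro x y hxy
    have := congrArg
      (((s : (Module.End ℂ V)ˣ)⁻¹ : (Module.End ℂ V)ˣ) : Module.End ℂ V) hxy
    simpa only [aux_inv] using this

open PRG in
theorem aux_key {V : Type*} [AddCommGroup V] [Module ℂ V] [FiniteDimensional ℂ V]
    (G : Subgroup (Module.End ℂ V)ˣ) [Finite ↥G]
    (s t : ↥G) (hs : s ∈ Rset G) (ht : t ∈ Rset G)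
    (hne : hypOf (s : (Module.End ℂ V)ˣ) ≠ hypOf (t : (Module.End ℂ V)ˣ))
    (f g : V →ₗ[ℂ] ℂ) (a b : V) (ha : a ≠ 0) (hb : b ≠ 0)
    (hf : ∀ v, ((s : (Module.End ℂ V)ˣ) : Module.End ℂ V) v = v + f v • a)
    (hg : ∀ v, ((t : (Module.End ℂ V)ˣ) : Module.End ℂ V) v = v + g v • b)
    (hno : ∀ r : ↥G, r ∈ Rset G →
      hypOf (s : (Module.End ℂ V)ˣ) ⊓ hypOf (t : (Module.End ℂ V)ˣ)
        ≤ hypOf (r : (Module.End ℂ V)ˣ) →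
      hypOf (r : (Module.End ℂ V)ˣ) = hypOf (s : (Module.End ℂ V)ˣ) ∨
      hypOf (r : (Module.End ℂ V)ˣ) = hypOf (t : (Module.End ℂ V)ˣ)) : g a = 0 := by
  have hfin : Module.finrank ℂ (hypOf (s : (Module.End ℂ V)ˣ))
      = Module.finrank ℂ (hypOf (t : (Module.End ℂ V)ˣ)) := by
    have h1 := hs.2
    have h2 := ht.2
    unfold hypOf
    omega
  have hc := fun v => aux_conj (s : (Module.End ℂ V)ˣ) (t : (Module.End ℂ V)ˣ) v
  rcases hno (s * t * s⁻¹) (aux_conj_refl G s t ht) (by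
    intro v hv
    have h1 : ((s : (Module.End ℂ V)ˣ) : Module.End ℂ V) v = v := (aux_mem _ _).1 hv.1
    have := (hc v).2 hv.2
    rw [h1] at this
    exact this) with h | h
  · exfalso
    apply hne
    apply Submodule.eq_of_le_of_finrank_eq _ hfin
    intro v hv
    have h1 : ((s : (Module.End ℂ V)ˣ) : Module.End ℂ V) v = v := (aux_mem _ _).1 hv
    rw [← hc v, h1]
    rw [← h] at hv
    exact hv
  · by_contra hga
    apply hne
    symm
    apply Submodule.eq_of_le_of_finrank_eq _ hfin.symm
    intro v hv
    have h1 := (hc v).2 hv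
    have h2 : ((s : (Module.End ℂ V)ˣ) : Module.End ℂ V) v ∈ hypOf (t : (Module.End ℂ V)ˣ) := by
      rw [← h]; exact h1
    rw [aux_mem' _ g b hb hg] at hv h2
    rw [aux_mem' _ f a ha hf]
    rw [hf] at h2
    simpa [hv, hga] using h2

theorem aux_unip {V : Type*} [AddCommGroup V] [Module ℂ V]
    (M : Module.End ℂ V) (hM : M * M = 0) (n : ℕ) : (1 + M) ^ n = 1 + n • M := by
  induction n with
  | zero => simp
  | succ k ih =>
    rw [pow_succ, ih]
    simp only [add_mul, mul_add, smul_mul_assoc, hM, one_mul, mul_one, succ_nsmul, smul_zero]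
    abel

open PRG in
theorem aux_same {V : Type*} [AddCommGroup V] [Module ℂ V] [FiniteDimensional ℂ V]
    (G : Subgroup (Module.End ℂ V)ˣ) [Finite ↥G]
    (s t : ↥G)
    (he : hypOf (s : (Module.End ℂ V)ˣ) = hypOf (t : (Module.End ℂ V)ˣ))
    (f g : V →ₗ[ℂ] ℂ) (a b : V) (ha : a ≠ 0) (hb : b ≠ 0)
    (hf : ∀ v, ((s : (Module.End ℂ V)ˣ) : Module.End ℂ V) v = v + f v • a)
    (hg : ∀ v, ((t : (Module.End ℂ V)ˣ) : Module.End ℂ V) v = v + g v • b) :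
    s * t = t * s := by
  have hk : ∀ v, f v = 0 ↔ g v = 0 := by
    intro v
    rw [← aux_mem' _ f a ha hf, ← aux_mem' _ g b hb hg, he]
  have hprop : ∀ v w, f v * g w = f w * g v := by
    intro v w
    have h1 : f (f v • w - f w • v) = 0 := by simp; ring
    have h2 := (hk _).1 h1
    simp at h2
    linear_combination h2
  set S : Module.End ℂ V := ((s : (Module.End ℂ V)ˣ) : Module.End ℂ V) with hS
  set T : Module.End ℂ V := ((t : (Module.End ℂ V)ˣ) : Module.End ℂ V) with hT
  set W : Module.End ℂ V :=
    ((((t * s : ↥G)⁻¹ : ↥G) : (Module.End ℂ V)ˣ) : Module.End ℂ V) with hW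
  have hWTS : (T * S) * W = 1 := by
    have h := mul_inv_cancel (t * s)
    exact congrArg (fun x : ↥G => ((x : (Module.End ℂ V)ˣ) : Module.End ℂ V)) h
  have hWTS' : W * (T * S) = 1 := by
    have h := inv_mul_cancel (t * s)
    exact congrArg (fun x : ↥G => ((x : (Module.End ℂ V)ˣ) : Module.End ℂ V)) h
  have hD : ∀ v, (S * T - T * S) v = (g v * f b) • a - (f v * g a) • b := by
    intro v
    simp only [LinearMap.sub_apply, Module.End.mul_apply, hf, hg, map_add, map_smul, smul_eq_mul]
    module
  have hDf : ∀ v, f ((S * T - T * S) v) = 0 := by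
    intro v
    rw [hD]
    simp only [map_sub, map_smul, smul_eq_mul]
    linear_combination f b * hprop a v
  have hDk : ∀ v, f v = 0 → (S * T - T * S) v = 0 := by
    intro v hv
    rw [hD, hv, (hk v).1 hv]
    simp
  have hfix : ∀ v, f v = 0 → W v = v := by
    intro v hv
    have h1 : (T * S) v = v := by
      rw [Module.End.mul_apply, hf, hv, zero_smul, add_zero, hg, (hk v).1 hv, zero_smul, add_zero]
    calc W v = W ((T * S) v) := by rw [h1]
      _ = (W * (T * S)) v := rfl
      _ = v := by rw [hWTS']; rfl
  have hMM : ((S * T - T * S) * W) * ((S * T - T * S) * W) = 0 := by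
    ext v
    change (S * T - T * S) (W ((S * T - T * S) (W v))) = 0
    rw [hfix _ (hDf _)]
    exact hDk _ (hDf _)
  have hc : (((s * t * (t * s)⁻¹ : ↥G) : (Module.End ℂ V)ˣ) : Module.End ℂ V)
      = 1 + (S * T - T * S) * W := by
    rw [sub_mul, hWTS]
    rw [add_sub_cancel]
    rfl
  obtain ⟨n, hn, hpow⟩ := (isOfFinOrder_of_finite (s * t * (t * s)⁻¹)).exists_pow_eq_one
  have h1 : (1 + (S * T - T * S) * W) ^ n = 1 := by
    rw [← hc]
    exact congrArg (fun x : ↥G => ((x : (Module.End ℂ V)ˣ) : Module.End ℂ V)) hpow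
  rw [aux_unip _ hMM] at h1
  have h2 : n • ((S * T - T * S) * W) = 0 := by simpa using h1
  have h3 : (S * T - T * S) * W = 0 := by
    rw [← Nat.cast_smul_eq_nsmul ℂ] at h2
    rcases smul_eq_zero.1 h2 with h | h
    · exact absurd (Nat.cast_eq_zero.1 h) hn.ne'
    · exact h
  rw [h3, add_zero] at hc
  have h4 : s * t * (t * s)⁻¹ = 1 := Subtype.ext (Units.ext hc)
  exact mul_inv_eq_one.1 h4

open PRG in
/-- if two pseudo reflections of a finite pseudo reflection group do not
commute, then some reflection hyperplane other than their own contains the intersection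
of their reflection hyperplanes. -/
theorem exists_third_hyperplane_of_not_commute
    {V : Type*} [AddCommGroup V] [Module ℂ V] [FiniteDimensional ℂ V]
    (G : Subgroup (Module.End ℂ V)ˣ) [Finite ↥G]
    (hG : IsPseudoReflectionGroup G)
    (s₁ s₂ : ↥G) (hs₁ : s₁ ∈ Rset G) (hs₂ : s₂ ∈ Rset G)
    (hnc : s₁ * s₂ ≠ s₂ * s₁) :
    ∃ s : ↥G, s ∈ Rset G ∧
      hypOf (s₁ : (Module.End ℂ V)ˣ) ⊓ hypOf (s₂ : (Module.End ℂ V)ˣ)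
        ≤ hypOf (s : (Module.End ℂ V)ˣ) ∧
      hypOf (s : (Module.End ℂ V)ˣ) ≠ hypOf (s₁ : (Module.End ℂ V)ˣ) ∧
      hypOf (s : (Module.End ℂ V)ˣ) ≠ hypOf (s₂ : (Module.End ℂ V)ˣ) := by
  by_contra hcon
  obtain ⟨f, a, ha, hf⟩ := aux_form _ hs₁
  obtain ⟨g, b, hb, hg⟩ := aux_form _ hs₂
  apply hnc
  by_cases he : hypOf (s₁ : (Module.End ℂ V)ˣ) = hypOf (s₂ : (Module.End ℂ V)ˣ)
  · exact aux_same G s₁ s₂ he f g a b ha hb hf hg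
  have hno : ∀ r : ↥G, r ∈ Rset G →
      hypOf (s₁ : (Module.End ℂ V)ˣ) ⊓ hypOf (s₂ : (Module.End ℂ V)ˣ)
        ≤ hypOf (r : (Module.End ℂ V)ˣ) →
      hypOf (r : (Module.End ℂ V)ˣ) = hypOf (s₁ : (Module.End ℂ V)ˣ) ∨
      hypOf (r : (Module.End ℂ V)ˣ) = hypOf (s₂ : (Module.End ℂ V)ˣ) := by
    intro r hr hle
    by_contra hh
    rw [not_or] at hh
    exact hcon ⟨r, hr, hle, hh.1, hh.2⟩
  have h1 : g a = 0 := aux_key G s₁ s₂ hs₁ hs₂ he f g a b ha hb hf hg hno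
  have h2 : f b = 0 := aux_key G s₂ s₁ hs₂ hs₁ (Ne.symm he) g f b a hb ha hg hf
    (fun r hr hle => (hno r hr (by rwa [inf_comm])).symm)
  apply Subtype.ext
  apply Units.ext
  ext v
  change ((s₁ : (Module.End ℂ V)ˣ) : Module.End ℂ V) (((s₂ : (Module.End ℂ V)ˣ) : Module.End ℂ V) v)
    = ((s₂ : (Module.End ℂ V)ˣ) : Module.End ℂ V) (((s₁ : (Module.End ℂ V)ˣ) : Module.End ℂ V) v)
  simp only [hf, hg, map_add, map_smul, smul_eq_mul, h1, h2]
  module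
end
end

section
/- For every finite pseudo reflection group (V, G) and every parameter set Υ, the algebra B_G(Υ) is finite dimensional over ℂ, and the assignment w ↦ w̄ induces an injective ℂ-algebra homomorphism from the group algebra ℂG into B_G(Υ). -/
noncomputable section

open scoped Classical

namespace PRG

variable {V : Type*} [AddCommGroup V] [Module ℂ V]
variable (G : Subgroup (Module.End ℂ V)ˣ) (μ : ↥G → ℂ) (mc : Submodule ℂ V → ℂ)

/-- The retraction of `B_G` onto the group algebra sending every `e_i` to zero. -/
def retr : BAlg G μ mc →ₐ[ℂ] MonoidAlgebra ℂ ↥G :=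
  RingQuot.liftAlgHom ℂ ⟨FreeAlgebra.lift ℂ
    (Sum.elim (fun w => MonoidAlgebra.of ℂ ↥G w) (fun _ => 0)), by
    intro x y h
    have he : ∀ i, (FreeAlgebra.lift ℂ (Sum.elim (fun w => MonoidAlgebra.of ℂ ↥G w)
        (fun _ => 0))) (ee G i) = 0 := by
      intro i
      simp [ee]
    have hg : ∀ w, (FreeAlgebra.lift ℂ (Sum.elim (fun w => MonoidAlgebra.of ℂ ↥G w)
        (fun _ => 0))) (gg G w) = MonoidAlgebra.of ℂ ↥G w := by
      intro i
      simp [gg]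
    cases h with
    | grp_one => rw [hg, map_one, map_one]
    | grp_mul w₁ w₂ => rw [map_mul, hg, hg, hg, map_mul]
    | _ => simp only [map_mul, map_smul, he, mul_zero, zero_mul, smul_zero, map_zero]⟩

lemma retr_wbar (w : ↥G) : retr G μ mc (wbar G μ mc w) = MonoidAlgebra.of ℂ ↥G w := by
  unfold retr wbar
  erw [RingQuot.liftAlgHom_mkAlgHom_apply]
  simp [gg]

lemma groupAlgebraMap_inj : Function.Injective (groupAlgebraMap G μ mc) := by
  have h : (retr G μ mc).comp (groupAlgebraMap G μ mc) = AlgHom.id ℂ _ := by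
    have hw : ∀ w : ↥G, retr G μ mc (groupAlgebraMap G μ mc (MonoidAlgebra.single w 1)) =
        MonoidAlgebra.single w 1 := by
      intro w
      have h2 : groupAlgebraMap G μ mc (MonoidAlgebra.single w 1) = wbar G μ mc w := by
        simp only [groupAlgebraMap, MonoidAlgebra.lift_single, one_smul]
        rfl
      rw [h2, retr_wbar]
      rfl
    apply MonoidAlgebra.algHom_ext
    · exact hw
    · exact Subsingleton.elim _ _
  intro x y hxy
  have h1 := DFunLike.congr_fun h x
  have h2 := DFunLike.congr_fun h y
  simp only [AlgHom.comp_apply, AlgHom.id_apply] at h1 h2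
  rw [← h1, ← h2, hxy]

lemma hypOf_conj (w s : (Module.End ℂ V)ˣ) :
    hypOf (w * s * w⁻¹) = Submodule.map (w : Module.End ℂ V) (hypOf s) := by
  have hw : ∀ x, (w : Module.End ℂ V) ((↑w⁻¹ : Module.End ℂ V) x) = x := fun x => by
    rw [← Module.End.mul_apply, Units.mul_inv, Module.End.one_apply]
  have hw' : ∀ x, (↑w⁻¹ : Module.End ℂ V) ((w : Module.End ℂ V) x) = x := fun x => by
    rw [← Module.End.mul_apply, Units.inv_mul, Module.End.one_apply]
  ext x
  simp only [hypOf, LinearMap.mem_ker, Submodule.mem_map, LinearMap.sub_apply,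
    Module.End.one_apply, Units.val_mul, Module.End.mul_apply, sub_eq_zero]
  constructor
  · intro h
    refine ⟨(↑w⁻¹ : Module.End ℂ V) x, ?_, hw x⟩
    conv_rhs => rw [← h]
    rw [hw']
  · rintro ⟨y, hy, rfl⟩
    rw [hw', hy]

lemma map_mem_Pset (w : ↥G) (i : Submodule ℂ V) (hi : i ∈ Pset G) :
    Submodule.map ((w : (Module.End ℂ V)ˣ) : Module.End ℂ V) i ∈ Pset G := by
  obtain ⟨s, hs, rfl⟩ := hi
  refine ⟨w * s * w⁻¹, ?_, ?_⟩
  · refine ⟨?_, ?_⟩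
    · have := hs.1
      exact MonoidHom.isOfFinOrder (MulAut.conj (w : (Module.End ℂ V)ˣ)).toMonoidHom this
    · have h2 := hs.2
      have h4 := hypOf_conj (w : (Module.End ℂ V)ˣ) (s : (Module.End ℂ V)ˣ)
      change Module.finrank ℂ (hypOf ((w : (Module.End ℂ V)ˣ) * (s : (Module.End ℂ V)ˣ) * (w : (Module.End ℂ V)ˣ)⁻¹))
        + 1 = _
      change Module.finrank ℂ (hypOf (s : (Module.End ℂ V)ˣ)) + 1 = _ at h2
      rw [h4, ← h2]
      congr 1
      refine LinearEquiv.finrank_eq (Submodule.equivMapOfInjective _ ?_ _).symm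
      intro x y hxy
      have h3 := congrArg (((w : (Module.End ℂ V)ˣ)⁻¹ : (Module.End ℂ V)ˣ) : Module.End ℂ V) hxy
      rwa [← Module.End.mul_apply, ← Module.End.mul_apply, Units.inv_mul] at h3
  · simp only [Subgroup.coe_mul, Subgroup.coe_inv]
    exact hypOf_conj _ _

/-- Product of the generators `e_i` along a list. -/
def ep (l : List ↥(Pset G)) : BAlg G μ mc := (l.map (ebar G μ mc)).prod

lemma wbar_mul (w₁ w₂ : ↥G) :
    wbar G μ mc w₁ * wbar G μ mc w₂ = wbar G μ mc (w₁ * w₂) :=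
  ((wbarMonoidHom G μ mc).map_mul w₁ w₂).symm

lemma wbar_one : wbar G μ mc 1 = 1 := (wbarMonoidHom G μ mc).map_one

lemma e_wbar (w : ↥G) (i : ↥(Pset G)) : ∃ j : ↥(Pset G),
    ebar G μ mc i * wbar G μ mc w = wbar G μ mc w * ebar G μ mc j := by
  refine ⟨⟨_, map_mem_Pset G w⁻¹ i i.2⟩, ?_⟩
  have h := RingQuot.mkAlgHom_rel ℂ (BRel.move (μ := μ) (mc := mc) w i
    ⟨_, map_mem_Pset G w⁻¹ i i.2⟩ (by
      rw [← Submodule.map_comp]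
      convert Submodule.map_id _
      change ((w : (Module.End ℂ V)ˣ) : Module.End ℂ V) * _ = 1
      simp))
  rw [map_mul, map_mul] at h
  exact h.symm

/-- Span of the elements `w̄ e_l` with `l` satisfying `p`. -/
def Sp (p : List ↥(Pset G) → Prop) : Submodule ℂ (BAlg G μ mc) :=
  Submodule.span ℂ {x | ∃ w l, p l ∧ x = wbar G μ mc w * ep G μ mc l}

variable {G μ mc}

lemma Sp_mem {p : List ↥(Pset G) → Prop} (w : ↥G) {l} (h : p l) :
    wbar G μ mc w * ep G μ mc l ∈ Sp G μ mc p :=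
  Submodule.subset_span ⟨w, l, h, rfl⟩

lemma Sp_mem' {p : List ↥(Pset G) → Prop} {l} (h : p l) :
    ep G μ mc l ∈ Sp G μ mc p := by
  have := Sp_mem (μ := μ) (mc := mc) 1 h
  rwa [wbar_one, one_mul] at this

lemma wbar_Sp {p : List ↥(Pset G) → Prop} (w : ↥G) {x} (hx : x ∈ Sp G μ mc p) :
    wbar G μ mc w * x ∈ Sp G μ mc p := by
  unfold Sp at hx
  induction hx using Submodule.span_induction with
  | mem x h =>
    obtain ⟨w', l, hl, rfl⟩ := h
    rw [← mul_assoc, wbar_mul]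
    exact Sp_mem _ hl
  | zero => simp
  | add x y _ _ hx hy => rw [mul_add]; exact add_mem hx hy
  | smul a x _ hx => rw [mul_smul_comm]; exact Submodule.smul_mem _ _ hx

lemma ebar_Sp {p q : List ↥(Pset G) → Prop} (hpq : ∀ i l, p l → q (i :: l))
    (i : ↥(Pset G)) {x} (hx : x ∈ Sp G μ mc p) :
    ebar G μ mc i * x ∈ Sp G μ mc q := by
  unfold Sp at hx
  induction hx using Submodule.span_induction with
  | mem x h =>
    obtain ⟨w', l, hl, rfl⟩ := h
    obtain ⟨j, hj⟩ := e_wbar G μ mc w' i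
    rw [← mul_assoc, hj, mul_assoc]
    have := Sp_mem (μ := μ) (mc := mc) w' (hpq j l hl)
    simpa [ep] using this
  | zero => simp
  | add x y _ _ hx hy => rw [mul_add]; exact add_mem hx hy
  | smul a x _ hx => rw [mul_smul_comm]; exact Submodule.smul_mem _ _ hx

lemma ee_lower [Finite ↥G] (i j : ↥(Pset G))
    (h : {k : ↥(Pset G) | (i : Submodule ℂ V) ⊓ (j : Submodule ℂ V) ≤ (k : Submodule ℂ V)}
        ≠ {i, j}) (l) :
    ep G μ mc (i :: j :: l) ∈ Sp G μ mc (fun l' => l'.length < l.length + 2) := by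
  have e : ep G μ mc (i :: j :: l) = ebar G μ mc i * ebar G μ mc j * ep G μ mc l := by
    simp [ep, mul_assoc]
  have hl : ebar G μ mc j * ep G μ mc l ∈ Sp G μ mc (fun l' => l'.length < l.length + 2) := by
    have := Sp_mem' (μ := μ) (mc := mc) (p := fun l' => l'.length < l.length + 2)
      (l := j :: l) (by simp)
    simpa [ep] using this
  rw [e]
  rcases (Rij G (i : Submodule ℂ V) (j : Submodule ℂ V)).eq_empty_or_nonempty with h2 | h2
  · have := RingQuot.mkAlgHom_rel ℂ (BRel.e_zero (μ := μ) (mc := mc) i j h h2)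
    rw [map_mul, map_zero] at this
    have h3 : ebar G μ mc i * ebar G μ mc j = 0 := this
    rw [h3, zero_mul]
    exact zero_mem _
  · have := RingQuot.mkAlgHom_rel ℂ (BRel.e_sum (μ := μ) (mc := mc) i j h h2)
    rw [map_mul, map_mul, finsum_mem_eq_finite_toFinset_sum _ (Set.toFinite _), map_sum] at this
    simp only [map_smul] at this
    have h3 : ebar G μ mc i * ebar G μ mc j =
      (∑ s ∈ (Set.toFinite (Rij G (i : Submodule ℂ V) (j : Submodule ℂ V))).toFinset,
        μ s • wbar G μ mc s) * ebar G μ mc j := this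
    rw [h3, mul_assoc, Finset.sum_mul]
    refine sum_mem fun s _ => ?_
    rw [smul_mul_assoc]
    exact Submodule.smul_mem _ _ (wbar_Sp s hl)

lemma perm_lower [Finite ↥G] {l l' : List ↥(Pset G)} (h : l.Perm l') :
    ep G μ mc l - ep G μ mc l' ∈ Sp G μ mc (fun k => k.length < l.length) := by
  induction h with
  | nil => simp
  | cons a h ih =>
    have := ebar_Sp (q := fun k => k.length < (List.length _) + 1) (fun i l h => by
      simpa using h) a ih
    rw [mul_sub] at this
    simpa [ep] using this
  | swap a b l =>
    by_cases h : {k : ↥(Pset G) | (b : Submodule ℂ V) ⊓ (a : Submodule ℂ V)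
        ≤ (k : Submodule ℂ V)} = {b, a}
    · have := RingQuot.mkAlgHom_rel ℂ (BRel.e_comm (μ := μ) (mc := mc) b a h)
      rw [map_mul, map_mul] at this
      have h3 : ebar G μ mc b * ebar G μ mc a = ebar G μ mc a * ebar G μ mc b := this
      have h4 : ep G μ mc (b :: a :: l) = ep G μ mc (a :: b :: l) := by
        simp [ep, ← mul_assoc, h3]
      rw [h4, sub_self]
      exact zero_mem _
    · have h' : {k : ↥(Pset G) | (a : Submodule ℂ V) ⊓ (b : Submodule ℂ V)
        ≤ (k : Submodule ℂ V)} ≠ {a, b} := by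
        rwa [inf_comm, Set.pair_comm]
      exact sub_mem (ee_lower b a h l) (ee_lower a b h' l)
  | trans h1 h2 ih1 ih2 =>
    rw [← h1.length_eq] at ih2
    have := add_mem ih1 ih2
    rwa [sub_add_sub_cancel] at this

lemma ep_mem [Finite ↥G] (l : List ↥(Pset G)) : ep G μ mc l ∈ Sp G μ mc List.Nodup := by
  induction hn : l.length using Nat.strong_induction_on generalizing l with
  | _ n ih =>
    by_cases hl : l.Nodup
    · exact Sp_mem' hl
    · have hle : Sp G μ mc (fun k => k.length < l.length) ≤ Sp G μ mc List.Nodup := by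
        refine Submodule.span_le.2 ?_
        rintro _ ⟨w, k, hk, rfl⟩
        exact wbar_Sp w (ih _ (hn ▸ hk) k rfl)
      rw [List.nodup_iff_sublist] at hl
      push Not at hl
      obtain ⟨a, ha⟩ := hl
      obtain ⟨l', hl'⟩ := ha.exists_perm_append
      have h1 := hle (perm_lower (μ := μ) (mc := mc) hl')
      have h2 : ep G μ mc ([a, a] ++ l') = mc a • ep G μ mc (a :: l') := by
        have := RingQuot.mkAlgHom_rel ℂ (BRel.e_sq (μ := μ) (mc := mc) a)
        rw [map_mul, map_smul] at this
        have h3 : ebar G μ mc a * ebar G μ mc a = mc a • ebar G μ mc a := this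
        simp [ep, ← mul_assoc, h3]
      have h4 : ep G μ mc (a :: l') ∈ Sp G μ mc List.Nodup := by
        refine ih _ ?_ _ rfl
        have := hl'.length_eq
        simp at this ⊢
        omega
      have h5 := add_mem h1 (Submodule.smul_mem _ (mc a) h4)
      rwa [← h2, sub_add_cancel] at h5

lemma Sp_eq_top [Finite ↥G] : Sp G μ mc List.Nodup = ⊤ := by
  have hle : Sp G μ mc (fun _ => True) ≤ Sp G μ mc List.Nodup := by
    refine Submodule.span_le.2 ?_
    rintro _ ⟨w, k, -, rfl⟩
    exact wbar_Sp w (ep_mem k)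
  have key : ∀ x : FreeAlgebra ℂ (↥G ⊕ ↥(Pset G)), ∀ t ∈ Sp G μ mc (fun _ => True),
      (show BAlg G μ mc from RingQuot.mkAlgHom ℂ (BRel G μ mc) x) * t
        ∈ Sp G μ mc (fun _ => True) := by
    intro x
    induction x using FreeAlgebra.induction with
    | grade0 r =>
      intro t ht
      rw [AlgHom.commutes]
      have : (algebraMap ℂ (BAlg G μ mc) r) * t ∈ Sp G μ mc (fun _ => True) := by
        rw [← Algebra.smul_def]
        exact Submodule.smul_mem _ _ ht
      exact this
    | grade1 x =>
      intro t ht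
      cases x with
      | inl w => exact wbar_Sp w ht
      | inr i => exact ebar_Sp (fun _ _ _ => trivial) i ht
    | mul a b ha hb =>
      intro t ht
      rw [map_mul]
      have := ha _ (hb t ht)
      rw [← mul_assoc] at this
      exact this
    | add a b ha hb =>
      intro t ht
      rw [map_add]
      have := add_mem (ha t ht) (hb t ht)
      rw [← add_mul] at this
      exact this
  rw [eq_top_iff]
  rintro x -
  apply hle
  obtain ⟨y, rfl⟩ := RingQuot.mkAlgHom_surjective ℂ (BRel G μ mc) x
  have h1 : (1 : BAlg G μ mc) ∈ Sp G μ mc (fun _ => True) := by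
    have := Sp_mem' (μ := μ) (mc := mc) (p := fun _ => True) (l := []) trivial
    simpa [ep] using this
  have := key y 1 h1
  rw [mul_one] at this
  exact this

lemma BAlg_finite [Finite ↥G] : FiniteDimensional ℂ (BAlg G μ mc) := by
  have hP : Finite ↥(Pset G) := (Set.toFinite (Rset G)).image _
  have := Fintype.ofFinite ↥(Pset G)
  have hf : {l : List ↥(Pset G) | l.Nodup}.Finite :=
    (List.finite_length_le _ (Fintype.card ↥(Pset G))).subset fun l hl => hl.length_le_card
  refine ⟨⟨?_, ?_⟩⟩
  · exact (Set.Finite.image2 (fun w l => wbar G μ mc w * ep G μ mc l)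
      (Set.toFinite (Set.univ : Set ↥G)) hf).toFinset
  · rw [← Sp_eq_top, Set.Finite.coe_toFinset, Sp]
    congr 1
    ext x
    simp [Set.mem_image2, eq_comm]

end PRG

open PRG in
/-- for every finite pseudo reflection group `(V, G)` and parameters `Υ`,
the algebra `B_G(Υ)` is finite dimensional over `ℂ` and `w ↦ w̄` induces an injective
`ℂ`-algebra homomorphism `ℂG → B_G(Υ)`. -/
theorem BAlg_finiteDimensional_and_groupAlgebra_injective
    {V : Type*} [AddCommGroup V] [Module ℂ V] [FiniteDimensional ℂ V]
    (G : Subgroup (Module.End ℂ V)ˣ) [Finite ↥G]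
    (hG : IsPseudoReflectionGroup G)
    (μ : ↥G → ℂ) (mc : Submodule ℂ V → ℂ)
    (hμ : MuAdmissible G μ) (hm : MAdmissible G mc) :
    FiniteDimensional ℂ (BAlg G μ mc) ∧ Function.Injective (groupAlgebraMap G μ mc) := by
  exact ⟨BAlg_finite, groupAlgebraMap_inj G μ mc⟩
end
end
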